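/- Let n ≥ p. Then every minimal second syzygy of W_{n,p} is isomorphic, as an A-module, to W_{n+p,p}. -/

import Mathlib

open MvPolynomial Module

set_option maxHeartbeats 1000000
set_option synthInstance.maxHeartbeats 400000

noncomputable section

/-- The defining ideal `(X^p, Y^p)` of the polynomial ring in two variables. -/
def relI (k : Type) [Field k] (p : ℕ) : Ideal (MvPolynomial (Fin 2) k) :=
  Ideal.span {(X 0 : MvPolynomial (Fin 2) k) ^ p, (X 1 : MvPolynomial (Fin 2) k) ^ p}

/-- The algebra `A = k[X,Y]/(X^p, Y^p)`. -/
abbrev Amod (k : Type) [Field k] (p : ℕ) : Type :=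
  MvPolynomial (Fin 2) k ⧸ relI k p

variable (k : Type) [Field k] (p : ℕ)

/-- `x`, the image of `X` in `A`. -/
def xA : Amod k p := Ideal.Quotient.mk (relI k p) (X 0)

/-- `y`, the image of `Y` in `A`. -/
def yA : Amod k p := Ideal.Quotient.mk (relI k p) (X 1)

/-- The maximal ideal `𝔪 = (x, y)` of `A`. -/
def mA : Ideal (Amod k p) := Ideal.span {xA k p, yA k p}

/-- A point operator: `u = α x + β y` with `(α, β) ≠ (0, 0)`. -/
def IsPointOp (u : Amod k p) : Prop :=
  ∃ α β : k, (α ≠ 0 ∨ β ≠ 0) ∧ u = α • xA k p + β • yA k p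

/-- Equal images property: `u M = 𝔪 M` for every point operator `u`. -/
def EIP (M : Type) [AddCommGroup M] [Module (Amod k p) M] : Prop :=
  ∀ u : Amod k p, IsPointOp k p u →
    LinearMap.range (LinearMap.lsmul (Amod k p) M u)
      = mA k p • (⊤ : Submodule (Amod k p) M)

/-- `M` lies in `EIP_d`: equal images property and `𝔪^d M = 0`. -/
def EIPd (d : ℕ) (M : Type) [AddCommGroup M] [Module (Amod k p) M] : Prop :=
  EIP k p M ∧ (mA k p) ^ d • (⊤ : Submodule (Amod k p) M) = ⊥


/-- The standard basis vector `v_i` of the free module `A^n`. -/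
def stdV (n : ℕ) (i : Fin n) : Fin n → Amod k p := Pi.single i 1

/-- The set of defining relations of the module `W_{n,d}` inside the free module `A^n`
(indices of `v_1, …, v_n` are `0, …, n-1`): `x·v_1`, `y·v_n`, `x^d·v_i` for `2 ≤ i ≤ n`,
and `y·v_i − x·v_{i+1}` for `1 ≤ i ≤ n−1`. -/
def NSet (n d : ℕ) : Set (Fin n → Amod k p) :=
  (⋃ (i : Fin n) (_ : i.val = 0), {xA k p • stdV k p n i}) ∪
  (⋃ (i : Fin n) (_ : i.val = n - 1), {yA k p • stdV k p n i}) ∪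
  (⋃ (i : Fin n) (_ : i.val ≠ 0), {(xA k p) ^ d • stdV k p n i}) ∪
  (⋃ (i : Fin n) (j : Fin n) (_ : j.val = i.val + 1),
    {yA k p • stdV k p n i - xA k p • stdV k p n j})

/-- The submodule `N_{n,d} ⊆ A^n` of defining relations of `W_{n,d}`. -/
def NSub (n d : ℕ) : Submodule (Amod k p) (Fin n → Amod k p) :=
  Submodule.span (Amod k p) (NSet k p n d)

/-- The module `W_{n,d} = A^n / N_{n,d}`. -/
abbrev Wmod (n d : ℕ) : Type := (Fin n → Amod k p) ⧸ NSub k p n d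

/-- `IsMinSyz m N M`: the `A`-module `N` is a minimal `m`-th syzygy of `M`, i.e. it arises
(up to isomorphism) as the last kernel `ker(F_{m−1} → F_{m−2})` of an exact sequence
`F_{m−1} → ⋯ → F_1 → F_0 → M → 0` of finitely generated free `A`-modules `F_i` with
`ker(F_0 → M) ⊆ 𝔪F_0` and `ker(F_i → F_{i−1}) ⊆ 𝔪F_i`; equivalently, it is obtained by
`m`-fold iteration of minimal first syzygies. -/
def IsMinSyz : ℕ → ModuleCat.{0} (Amod k p) → ModuleCat.{0} (Amod k p) → Prop
  | 0, N, M => Nonempty ((↥N) ≃ₗ[Amod k p] (↥M))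
  | (m + 1), N, M => ∃ (r : ℕ) (g : (Fin r → Amod k p) →ₗ[Amod k p] M),
      Function.Surjective g ∧
      LinearMap.ker g ≤ mA k p • (⊤ : Submodule (Amod k p) (Fin r → Amod k p)) ∧
      IsMinSyz m N (ModuleCat.of (Amod k p) (↥(LinearMap.ker g)))

/-! ### Coefficients of elements of `A` -/

/-- The exponent vector `(a, b)`. -/
def expo (a b : ℕ) : Fin 2 →₀ ℕ := Finsupp.single 0 a + Finsupp.single 1 b

theorem expo_zero (a b : ℕ) : expo a b 0 = a := by simp [expo]
theorem expo_one (a b : ℕ) : expo a b 1 = b := by simp [expo]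

theorem expo_eta (u : Fin 2 →₀ ℕ) : expo (u 0) (u 1) = u := by
  ext i; fin_cases i
  · exact expo_zero _ _
  · exact expo_one _ _

theorem expo_le (a b c d : ℕ) : expo a b ≤ expo c d ↔ a ≤ c ∧ b ≤ d := by
  rw [Finsupp.le_def]
  simp [Fin.forall_fin_two, expo_zero, expo_one]

theorem expo_sub (a b c d : ℕ) : expo a b - expo c d = expo (a - c) (b - d) := by
  ext i; fin_cases i
  · simp [expo_zero]
  · simp [expo_one]

theorem expo_inj (a b c d : ℕ) : expo a b = expo c d ↔ a = c ∧ b = d := by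
  constructor
  · intro h
    refine ⟨?_, ?_⟩
    · have := DFunLike.congr_fun h 0
      simpa [expo_zero] using this
    · have := DFunLike.congr_fun h 1
      simpa [expo_one] using this
  · rintro ⟨rfl, rfl⟩; rfl

theorem mem_relI (f : MvPolynomial (Fin 2) k) :
    f ∈ relI k p ↔ ∀ a b, a < p → b < p → coeff (expo a b) f = 0 := by
  have h : relI k p = Ideal.span ((fun s => monomial s (1 : k)) '' {expo p 0, expo 0 p}) := by
    unfold relI
    congr 1
    rw [Set.image_pair]
    simp [expo, X_pow_eq_monomial]
  rw [h, mem_ideal_span_monomial_image]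
  constructor
  · intro H a b ha hb
    by_contra hne
    obtain ⟨s, hs, hle⟩ := H (expo a b) (by rwa [MvPolynomial.mem_support_iff])
    rcases hs with rfl | rfl
    · rw [expo_le] at hle; omega
    · rw [expo_le] at hle; omega
  · intro H u hu
    rw [MvPolynomial.mem_support_iff] at hu
    rw [← expo_eta u] at hu ⊢
    by_cases h0 : u 0 < p
    · by_cases h1 : u 1 < p
      · exact absurd (H _ _ h0 h1) hu
      · exact ⟨expo 0 p, by simp, by rw [expo_le]; omega⟩
    · exact ⟨expo p 0, by simp, by rw [expo_le]; omega⟩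

/-- The coefficient of `x^a y^b` in an element of `A` (meaningful for `a, b < p`). -/
def coA (f : Amod k p) (a b : ℕ) : k := coeff (expo a b) (Quotient.out f)

theorem coA_mk (P : MvPolynomial (Fin 2) k) {a b : ℕ} (ha : a < p) (hb : b < p) :
    coA k p (Ideal.Quotient.mk (relI k p) P) a b = coeff (expo a b) P := by
  have h : Quotient.out (Ideal.Quotient.mk (relI k p) P) - P ∈ relI k p := by
    rw [← Ideal.Quotient.mk_eq_mk_iff_sub_mem]
    exact Quotient.out_eq (Ideal.Quotient.mk (relI k p) P)
  have := (mem_relI k p _).1 h a b ha hb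
  rw [coeff_sub, sub_eq_zero] at this
  exact this

theorem coA_ext {f g : Amod k p} (h : ∀ a b, a < p → b < p → coA k p f a b = coA k p g a b) :
    f = g := by
  obtain ⟨P, rfl⟩ := Ideal.Quotient.mk_surjective f
  obtain ⟨Q, rfl⟩ := Ideal.Quotient.mk_surjective g
  rw [Ideal.Quotient.mk_eq_mk_iff_sub_mem, mem_relI]
  intro a b ha hb
  have := h a b ha hb
  rw [coA_mk k p _ ha hb, coA_mk k p _ ha hb] at this
  rw [coeff_sub, this, sub_self]

theorem coA_zero {a b : ℕ} (ha : a < p) (hb : b < p) : coA k p 0 a b = 0 := by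
  have := coA_mk k p 0 ha hb
  simpa using this

theorem coA_add (f g : Amod k p) {a b : ℕ} (ha : a < p) (hb : b < p) :
    coA k p (f + g) a b = coA k p f a b + coA k p g a b := by
  obtain ⟨P, rfl⟩ := Ideal.Quotient.mk_surjective f
  obtain ⟨Q, rfl⟩ := Ideal.Quotient.mk_surjective g
  rw [← map_add, coA_mk k p _ ha hb, coA_mk k p _ ha hb, coA_mk k p _ ha hb, coeff_add]

theorem coA_sum {ι : Type} (s : Finset ι) (f : ι → Amod k p) {a b : ℕ} (ha : a < p) (hb : b < p) :
    coA k p (∑ i ∈ s, f i) a b = ∑ i ∈ s, coA k p (f i) a b := by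
  classical
  induction s using Finset.induction_on with
  | empty => simpa using coA_zero k p ha hb
  | insert i s hi ih => rw [Finset.sum_insert hi, Finset.sum_insert hi, coA_add k p _ _ ha hb, ih]

theorem xy_eq (s t : ℕ) : xA k p ^ s * yA k p ^ t
    = Ideal.Quotient.mk (relI k p) (monomial (expo s t) 1) := by
  unfold xA yA
  rw [← map_pow, ← map_pow, ← map_mul, X_pow_eq_monomial, X_pow_eq_monomial, monomial_mul, expo,
    one_mul]

theorem coA_mul (s t : ℕ) (f : Amod k p) {a b : ℕ} (ha : a < p) (hb : b < p) :
    coA k p (xA k p ^ s * yA k p ^ t * f) a b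
      = if s ≤ a ∧ t ≤ b then coA k p f (a - s) (b - t) else 0 := by
  obtain ⟨P, rfl⟩ := Ideal.Quotient.mk_surjective f
  rw [xy_eq, ← map_mul, coA_mk k p _ ha hb, coeff_monomial_mul', expo_sub, one_mul,
    coA_mk k p _ (by omega) (by omega)]
  simp only [expo_le]

theorem coA_x (f : Amod k p) {a b : ℕ} (ha : a < p) (hb : b < p) :
    coA k p (xA k p * f) a b = if 1 ≤ a then coA k p f (a - 1) b else 0 := by
  have := coA_mul k p 1 0 f ha hb
  simpa using this

theorem coA_y (f : Amod k p) {a b : ℕ} (ha : a < p) (hb : b < p) :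
    coA k p (yA k p * f) a b = if 1 ≤ b then coA k p f a (b - 1) else 0 := by
  have := coA_mul k p 0 1 f ha hb
  simpa using this

/-- The scalar `c` as an element of `A`. -/
def cA (c : k) : Amod k p := Ideal.Quotient.mk (relI k p) (C c)

theorem coA_cx (c : k) (s : ℕ) {a b : ℕ} (ha : a < p) (hb : b < p) :
    coA k p (cA k p c * xA k p ^ s) a b = if a = s ∧ b = 0 then c else 0 := by
  have h : cA k p c * xA k p ^ s = Ideal.Quotient.mk (relI k p) (monomial (expo s 0) c) := by
    unfold cA xA
    rw [← map_pow, ← map_mul, C_mul_X_pow_eq_monomial]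
    simp [expo]
  rw [h, coA_mk k p _ ha hb, coeff_monomial]
  congr 1
  rw [expo_inj]
  grind

theorem A_induction {P : Amod k p → Prop} (h0 : ∀ f g, P f → P g → P (f + g))
    (h1 : ∀ (c : k) (s t : ℕ), P (cA k p c * xA k p ^ s * yA k p ^ t)) (f : Amod k p) : P f := by
  obtain ⟨Q, rfl⟩ := Ideal.Quotient.mk_surjective f
  induction Q using MvPolynomial.induction_on' with
  | monomial u c =>
    have := h1 c (u 0) (u 1)
    have e : cA k p c * xA k p ^ (u 0) * yA k p ^ (u 1)
      = Ideal.Quotient.mk (relI k p) (monomial u c) := by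
      rw [mul_assoc, xy_eq, expo_eta, cA, ← map_mul, C_mul_monomial, mul_one]
    rwa [e] at this
  | add f g hf hg => rw [map_add]; exact h0 _ _ hf hg

theorem xA_pow_p : xA k p ^ p = 0 := by
  unfold xA
  rw [← map_pow, Ideal.Quotient.eq_zero_iff_mem]
  exact Ideal.subset_span (by simp)

theorem yA_pow_p : yA k p ^ p = 0 := by
  unfold yA
  rw [← map_pow, Ideal.Quotient.eq_zero_iff_mem]
  exact Ideal.subset_span (by simp)

theorem mA_le_jac : mA k p ≤ Ideal.jacobson ⊥ := by
  refine le_trans ?_ (Ideal.radical_le_jacobson)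
  unfold mA
  rw [Ideal.span_le]
  rintro z (rfl | rfl)
  · exact ⟨p, by rw [xA_pow_p]; exact zero_mem _⟩
  · exact ⟨p, by rw [yA_pow_p]; exact zero_mem _⟩

/-! ### Uniqueness of projective covers -/

theorem surj_of_sub {R : Type} [CommRing R] (I : Ideal R) (hI : I ≤ Ideal.jacobson ⊥)
    {r : ℕ} (u : (Fin r → R) →ₗ[R] (Fin r → R))
    (h : ∀ z, u z - z ∈ I • (⊤ : Submodule R (Fin r → R))) : Function.Bijective u := by
  have hs : Function.Surjective u := by
    rw [← LinearMap.range_eq_top]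
    rw [eq_top_iff]
    refine Submodule.le_of_le_smul_of_le_jacobson_bot (I := I) ?_ hI ?_
    · exact Module.Finite.fg_top
    · intro z _
      have : z = u z + -(u z - z) := by abel
      rw [this]
      exact Submodule.add_mem_sup ⟨z, rfl⟩ (neg_mem (h z))
  exact ⟨(OrzechProperty.injective_of_surjective_endomorphism u hs), hs⟩

theorem cover_unique {R : Type} [CommRing R] (I : Ideal R) (hI : I ≤ Ideal.jacobson ⊥)
    {M : Type} [AddCommGroup M] [Module R M] {r s : ℕ}
    (f : (Fin r → R) →ₗ[R] M) (g : (Fin s → R) →ₗ[R] M)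
    (hf : Function.Surjective f) (hg : Function.Surjective g)
    (kf : LinearMap.ker f ≤ I • ⊤) (kg : LinearMap.ker g ≤ I • ⊤) :
    ∃ e : (Fin r → R) ≃ₗ[R] (Fin s → R), ∀ z, g (e z) = f z := by
  obtain ⟨u, hu⟩ := Module.projective_lifting_property g f hg
  obtain ⟨v, hv⟩ := Module.projective_lifting_property f g hf
  have hu' : ∀ z, g (u z) = f z := fun z => LinearMap.congr_fun hu z
  have hv' : ∀ z, f (v z) = g z := fun z => LinearMap.congr_fun hv z
  have b1 := surj_of_sub I hI (v ∘ₗ u) (fun z => kf (by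
    rw [LinearMap.mem_ker, map_sub, LinearMap.comp_apply, hv', hu', sub_self]))
  have b2 := surj_of_sub I hI (u ∘ₗ v) (fun z => kg (by
    rw [LinearMap.mem_ker, map_sub, LinearMap.comp_apply, hu', hv', sub_self]))
  refine ⟨LinearEquiv.ofBijective u ⟨?_, ?_⟩, hu'⟩
  · intro a b hab
    apply b1.1
    simp [hab]
  · intro z
    obtain ⟨w, hw⟩ := b2.2 z
    exact ⟨v w, hw⟩

theorem ker_equiv {R : Type} [CommRing R] (I : Ideal R) (hI : I ≤ Ideal.jacobson ⊥)
    {M M' : Type} [AddCommGroup M] [Module R M] [AddCommGroup M'] [Module R M'] {r s : ℕ}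
    (E : M ≃ₗ[R] M')
    (f : (Fin r → R) →ₗ[R] M) (g : (Fin s → R) →ₗ[R] M')
    (hf : Function.Surjective f) (hg : Function.Surjective g)
    (kf : LinearMap.ker f ≤ I • ⊤) (kg : LinearMap.ker g ≤ I • ⊤) :
    Nonempty (LinearMap.ker f ≃ₗ[R] LinearMap.ker g) := by
  have hker : LinearMap.ker (E.toLinearMap ∘ₗ f) = LinearMap.ker f := by
    ext z; simp
  obtain ⟨e, he⟩ := cover_unique I hI (E.toLinearMap ∘ₗ f) g (E.surjective.comp hf) hg
    (by rwa [hker]) kg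
  refine ⟨e.ofSubmodules _ _ ?_⟩
  ext z
  rw [Submodule.mem_map, LinearMap.mem_ker]
  constructor
  · rintro ⟨w, hw, rfl⟩
    have := he w
    rw [LinearMap.mem_ker] at hw
    simpa [hw] using this
  · intro hz
    refine ⟨e.symm z, ?_, by simp⟩
    have := he (e.symm z)
    rw [LinearEquiv.apply_symm_apply, hz] at this
    simpa using this.symm

/-! ### The maps of the explicit resolution -/

/-- Extension by zero of a vector. -/
def ex {N : ℕ} (b : Fin N → Amod k p) (j : ℕ) : Amod k p := if h : j < N then b ⟨j, h⟩ else 0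

theorem ex_val {N : ℕ} (b : Fin N → Amod k p) (j : Fin N) : ex k p b j = b j := by
  simp [ex]

theorem ex_lt {N : ℕ} (b : Fin N → Amod k p) {j : ℕ} (h : j < N) : ex k p b j = b ⟨j, h⟩ := by
  simp [ex, h]

theorem ex_add {N : ℕ} (b c : Fin N → Amod k p) (j : ℕ) :
    ex k p (b + c) j = ex k p b j + ex k p c j := by
  unfold ex; split_ifs <;> simp

theorem ex_smul {N : ℕ} (r : Amod k p) (b : Fin N → Amod k p) (j : ℕ) :
    ex k p (r • b) j = r * ex k p b j := by
  unfold ex; split_ifs <;> simp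

/-- `φ : A^{n+1} → A^n`, `(φ a)_i = x a_i - y a_{i+1}`. -/
def phi (n : ℕ) : (Fin (n + 1) → Amod k p) →ₗ[Amod k p] (Fin n → Amod k p) where
  toFun a i := xA k p * ex k p a i - yA k p * ex k p a (i + 1)
  map_add' a b := by ext i; simp only [ex_add, Pi.add_apply]; ring
  map_smul' r a := by
    ext i; simp only [ex_smul, Pi.smul_apply, smul_eq_mul, RingHom.id_apply]; ring

/-- `ψ : A^{n+p} → A^{n+1}`, `(ψ b)_i = ∑_β x^{p-1-β} y^β b_{i+β}`. -/
def psi (n : ℕ) : (Fin (n + p) → Amod k p) →ₗ[Amod k p] (Fin (n + 1) → Amod k p) where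
  toFun b i := ∑ β ∈ Finset.range p, xA k p ^ (p - 1 - β) * yA k p ^ β * ex k p b (i + β)
  map_add' a b := by
    ext i; simp only [ex_add, Pi.add_apply, mul_add, Finset.sum_add_distrib]
  map_smul' r a := by
    ext i; simp only [ex_smul, Pi.smul_apply, smul_eq_mul, RingHom.id_apply, Finset.mul_sum]
    exact Finset.sum_congr rfl (fun _ _ => by ring)

theorem phi_apply (n : ℕ) (a : Fin (n + 1) → Amod k p) (i : Fin n) :
    phi k p n a i = xA k p * ex k p a i - yA k p * ex k p a (i + 1) := rfl

theorem psi_apply (n : ℕ) (b : Fin (n + p) → Amod k p) (i : Fin (n + 1)) :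
    psi k p n b i
      = ∑ β ∈ Finset.range p, xA k p ^ (p - 1 - β) * yA k p ^ β * ex k p b (i + β) := rfl

/-- The telescoping identity behind `φψ = 0` and `ψφ = 0`. -/
theorem telesc (c : ℕ → Amod k p) :
    xA k p * ∑ β ∈ Finset.range p, xA k p ^ (p - 1 - β) * yA k p ^ β * c β
      = yA k p * ∑ β ∈ Finset.range p, xA k p ^ (p - 1 - β) * yA k p ^ β * c (β + 1) := by
  rw [← sub_eq_zero, Finset.mul_sum, Finset.mul_sum, ← Finset.sum_sub_distrib]
  have := Finset.sum_range_sub' (fun β => xA k p ^ (p - β) * yA k p ^ β * c β) p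
  simp only [Nat.sub_zero, xA_pow_p, yA_pow_p, mul_zero, zero_mul, sub_self] at this
  rw [← this]
  refine Finset.sum_congr rfl (fun β hβ => ?_)
  rw [Finset.mem_range] at hβ
  have e1 : p - β = p - 1 - β + 1 := by omega
  have e2 : p - (β + 1) = p - 1 - β := by omega
  rw [e2, e1]
  ring

theorem phi_psi (n : ℕ) (b : Fin (n + p) → Amod k p) : phi k p n (psi k p n b) = 0 := by
  ext i
  have hi := i.2
  rw [phi_apply, ex_lt k p _ (show (i : ℕ) < n + 1 by omega),
    ex_lt k p _ (show (i : ℕ) + 1 < n + 1 by omega), psi_apply, psi_apply,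
    telesc k p (fun β => ex k p b (i + β)), Pi.zero_apply, sub_eq_zero]
  congr 1
  refine Finset.sum_congr rfl (fun β _ => ?_)
  congr 2
  simp only
  omega

theorem psi_phi (n : ℕ) (b : Fin (n + p + 1) → Amod k p) :
    psi k p n (phi k p (n + p) b) = 0 := by
  ext i
  have hi := i.2
  rw [psi_apply, Pi.zero_apply]
  have := telesc k p (fun β => ex k p b (i + β))
  rw [← sub_eq_zero, Finset.mul_sum, Finset.mul_sum, ← Finset.sum_sub_distrib] at this
  rw [← this]
  refine Finset.sum_congr rfl (fun β hβ => ?_)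
  rw [Finset.mem_range] at hβ
  rw [ex_lt k p _ (show (i : ℕ) + β < n + p by omega), phi_apply]
  simp only [add_assoc]
  ring

/-! ### Relations -/

theorem mul_smul_vec {N : ℕ} (a b : Amod k p) (v : Fin N → Amod k p) :
    (a * b) • v = a • (b • v) := by
  ext j; simp only [Pi.smul_apply, smul_eq_mul, mul_assoc]


theorem rel_x (n d : ℕ) (i : Fin n) (h : i.val = 0) : xA k p • stdV k p n i ∈ NSub k p n d :=
  Submodule.subset_span (Or.inl (Or.inl (Or.inl (by simp only [Set.mem_iUnion]; exact ⟨i, h, rfl⟩))))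

theorem rel_y (n d : ℕ) (i : Fin n) (h : i.val = n - 1) : yA k p • stdV k p n i ∈ NSub k p n d :=
  Submodule.subset_span (Or.inl (Or.inl (Or.inr (by simp only [Set.mem_iUnion]; exact ⟨i, h, rfl⟩))))

theorem rel_xy (n d : ℕ) (i j : Fin n) (h : j.val = i.val + 1) :
    yA k p • stdV k p n i - xA k p • stdV k p n j ∈ NSub k p n d :=
  Submodule.subset_span (Or.inr (by simp only [Set.mem_iUnion]; exact ⟨i, j, h, rfl⟩))

theorem ex_stdV (n : ℕ) (i : Fin n) (j : ℕ) :
    ex k p (stdV k p n i) j = if j = i.val then 1 else 0 := by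
  unfold ex stdV
  split_ifs with h1 h2 h2
  · have : (⟨j, h1⟩ : Fin n) = i := Fin.ext h2
    rw [this]; simp
  · rw [Pi.single_apply, if_neg]
    intro h; exact h2 (by rw [← h])
  · exact absurd (h2 ▸ i.2) h1
  · rfl

theorem stdV_apply (n : ℕ) (i j : Fin n) :
    stdV k p n i j = if j.val = i.val then 1 else 0 := by
  rw [← ex_val k p (stdV k p n i) j, ex_stdV]

theorem range_phi (n : ℕ) (hn : 1 ≤ n) : LinearMap.range (phi k p n) = NSub k p n p := by
  apply le_antisymm
  · rintro _ ⟨a, rfl⟩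
    have ha : a = ∑ i, a i • stdV k p (n + 1) i := by
      ext j
      simp [stdV, Finset.sum_apply, Pi.single_apply]
    rw [ha, map_sum]
    refine Submodule.sum_mem _ (fun i _ => ?_)
    rw [map_smul]
    refine Submodule.smul_mem _ _ ?_
    have hi := i.2
    rcases Nat.eq_zero_or_pos i.val with h0 | h0
    · have : phi k p n (stdV k p (n + 1) i) = xA k p • stdV k p n ⟨0, hn⟩ := by
        ext j
        rw [phi_apply, ex_stdV, ex_stdV, Pi.smul_apply, stdV_apply, h0]
        simp
      rw [this]; exact rel_x k p n p _ rfl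
    · by_cases h1 : i.val = n
      · have : phi k p n (stdV k p (n + 1) i) = - (yA k p • stdV k p n ⟨n - 1, by omega⟩) := by
          ext j
          have hj := j.2
          rw [phi_apply, ex_stdV, ex_stdV, Pi.neg_apply, Pi.smul_apply, stdV_apply, h1,
            if_neg (by omega)]
          by_cases h : j.val = n - 1
          · rw [if_pos (by omega), if_pos h]; simp
          · rw [if_neg (by omega), if_neg h]; simp
        rw [this]; exact neg_mem (rel_y k p n p _ rfl)
      · have : phi k p n (stdV k p (n + 1) i) = - (yA k p • stdV k p n ⟨i.val - 1, by omega⟩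
            - xA k p • stdV k p n ⟨i.val, by omega⟩) := by
          ext j
          rw [phi_apply, ex_stdV, ex_stdV, Pi.neg_apply, Pi.sub_apply, Pi.smul_apply, Pi.smul_apply,
            stdV_apply, stdV_apply]
          have e : (j.val + 1 = i.val) = (j.val = i.val - 1) := by
            apply propext; omega
          simp only [e, smul_eq_mul]
          ring
        rw [this]; exact neg_mem (rel_xy k p n p _ _ (by simp only; omega))
  · unfold NSub
    rw [Submodule.span_le]
    have key : ∀ (i : Fin n), phi k p n (stdV k p (n + 1) i.succ)
        = (if h : i.val + 1 < n then xA k p • stdV k p n ⟨i.val + 1, h⟩ else 0)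
          - yA k p • stdV k p n i := by
      intro i
      ext j
      have hj := j.2
      rw [phi_apply, ex_stdV, ex_stdV, Pi.sub_apply, Pi.smul_apply, stdV_apply]
      simp only [Fin.val_succ, add_left_inj, smul_eq_mul]
      congr 1
      split_ifs with h1 h2 h2
      · rw [Pi.smul_apply, stdV_apply]; simp [h1]
      · omega
      · rw [Pi.smul_apply, stdV_apply]; simp [h1]
      · simp
    rintro z (((hz | hz) | hz) | hz)
    · simp only [Set.mem_iUnion] at hz
      obtain ⟨i, hi, rfl⟩ := hz
      refine ⟨stdV k p (n + 1) 0, ?_⟩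
      ext j
      rw [phi_apply, ex_stdV, ex_stdV, Pi.smul_apply, stdV_apply, hi]
      by_cases h : j.val = 0 <;> simp [h]
    · simp only [Set.mem_iUnion] at hz
      obtain ⟨i, hi, rfl⟩ := hz
      refine ⟨- stdV k p (n + 1) i.succ, ?_⟩
      rw [map_neg, key, dif_neg (by omega)]
      simp
    · simp only [Set.mem_iUnion] at hz
      obtain ⟨i, hi, rfl⟩ := hz
      have : xA k p ^ p • stdV k p n i = 0 := by
        ext j; rw [Pi.smul_apply, xA_pow_p]; simp
      rw [this]
      exact zero_mem _
    · simp only [Set.mem_iUnion] at hz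
      obtain ⟨i, j, hj, rfl⟩ := hz
      refine ⟨- stdV k p (n + 1) i.succ, ?_⟩
      have : (⟨i.val + 1, hj ▸ j.2⟩ : Fin n) = j := Fin.ext hj.symm
      rw [map_neg, key, dif_pos (hj ▸ j.2), this]
      simp

/-! ### Exactness -/

theorem psi_coeff (n : ℕ) (b : Fin (n + p) → Amod k p)
    (hb : ∀ j s t, s < p → t < p → 0 < t → coA k p (ex k p b j) s t = 0)
    (i : Fin (n + 1)) {s t : ℕ} (hs : s < p) (ht : t < p) :
    coA k p (psi k p n b i) s t
      = if p - 1 ≤ s + t then coA k p (ex k p b (i + t)) (s + t - (p - 1)) 0 else 0 := by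
  rw [psi_apply, coA_sum k p _ _ hs ht, Finset.sum_eq_single t]
  · rw [coA_mul k p _ _ _ hs ht]
    by_cases h : p - 1 ≤ s + t
    · rw [if_pos h, if_pos (by omega)]
      congr 1
      · omega
      · omega
    · rw [if_neg h, if_neg (by omega)]
  · intro β hβ hne
    rw [Finset.mem_range] at hβ
    rw [coA_mul k p _ _ _ hs ht]
    split_ifs with h
    · exact hb _ _ _ (by omega) (by omega) (by omega)
    · rfl
  · intro h
    exact absurd (Finset.mem_range.2 ht) h

theorem ker_phi_le (n : ℕ) (hp : 1 ≤ p) (hn : p ≤ n) (a : Fin (n + 1) → Amod k p)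
    (ha : phi k p n a = 0) :
    ∃ b, psi k p n b = a := by
  have rel : ∀ i, i < n → xA k p * ex k p a i = yA k p * ex k p a (i + 1) := by
    intro i hi
    have := congrFun ha ⟨i, hi⟩
    rw [phi_apply, Pi.zero_apply, sub_eq_zero] at this
    exact this
  have R : ∀ i s t, i < n → s + 1 < p → t + 1 < p →
      coA k p (ex k p a i) s (t + 1) = coA k p (ex k p a (i + 1)) (s + 1) t := by
    intro i s t hi hs ht
    have := congrArg (fun f => coA k p f (s + 1) (t + 1)) (rel i hi)
    simpa [coA_x k p _ hs ht, coA_y k p _ hs ht] using this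
  have Z1 : ∀ i t, i < n → t + 1 < p → coA k p (ex k p a (i + 1)) 0 t = 0 := by
    intro i t hi ht
    have := congrArg (fun f => coA k p f 0 (t + 1)) (rel i hi)
    simpa [coA_x k p _ hp ht, coA_y k p _ hp ht] using this.symm
  have Z2 : ∀ i s, i < n → s + 1 < p → coA k p (ex k p a i) s 0 = 0 := by
    intro i s hi hs
    have := congrArg (fun f => coA k p f (s + 1) 0) (rel i hi)
    simpa [coA_x k p _ hs hp, coA_y k p _ hs hp] using this
  have L1 : ∀ s i t, s + t + 1 < p → s + 1 ≤ i → i ≤ n → coA k p (ex k p a i) s t = 0 := by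
    intro s
    induction s with
    | zero =>
      intro i t h1 h2 h3
      obtain ⟨i, rfl⟩ : ∃ i', i = i' + 1 := ⟨i - 1, by omega⟩
      exact Z1 i t (by omega) (by omega)
    | succ s ih =>
      intro i t h1 h2 h3
      obtain ⟨i, rfl⟩ : ∃ i', i = i' + 1 := ⟨i - 1, by omega⟩
      rw [← R i s t (by omega) (by omega) (by omega)]
      exact ih i (t + 1) (by omega) (by omega) (by omega)
  have L2 : ∀ t i s, s + t + 1 < p → i + t + 1 ≤ n → coA k p (ex k p a i) s t = 0 := by
    intro t
    induction t with
    | zero =>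
      intro i s h1 h2
      exact Z2 i s (by omega) (by omega)
    | succ t ih =>
      intro i s h1 h2
      rw [R i s t (by omega) (by omega) (by omega)]
      exact ih (i + 1) (s + 1) (by omega) (by omega)
  have chain : ∀ m i s t, i + m ≤ n → s + m < p → t + m < p →
      coA k p (ex k p a i) s (t + m) = coA k p (ex k p a (i + m)) (s + m) t := by
    intro m
    induction m with
    | zero => intro i s t _ _ _; rfl
    | succ m ih =>
      intro i s t h1 h2 h3
      have e1 := R i s (t + m) (by omega) (by omega) (by omega)
      have e2 := ih (i + 1) (s + 1) t (by omega) (by omega) (by omega)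
      rw [show t + (m + 1) = t + m + 1 by omega, e1, e2,
        show i + 1 + m = i + (m + 1) by omega, show s + 1 + m = s + (m + 1) by omega]
  -- the coefficients of the preimage
  let lam : ℕ → ℕ → k := fun j t =>
    coA k p (ex k p a (j - min j (p - 1))) (p - 1 + t - min j (p - 1)) (min j (p - 1))
  let b : Fin (n + p) → Amod k p := fun j =>
    ∑ t ∈ Finset.range p, cA k p (lam j t) * xA k p ^ t
  have hco : ∀ (j : Fin (n + p)) s t, s < p → t < p →
      coA k p (b j) s t = if t = 0 then lam j s else 0 := by
    intro j s t hs ht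
    simp only [b]
    rw [coA_sum k p _ _ hs ht, Finset.sum_eq_single s]
    · rw [coA_cx k p _ _ hs ht]; simp
    · intro s' _ hne
      rw [coA_cx k p _ _ hs ht, if_neg]
      rintro ⟨h, _⟩; exact hne h.symm
    · intro h; exact absurd (Finset.mem_range.2 hs) h
  refine ⟨b, ?_⟩
  ext i
  apply coA_ext
  intro s t hs ht
  have hi := i.2
  rw [psi_coeff k p n b ?_ i hs ht]
  · rw [← ex_val k p a i]
    split_ifs with h
    · rw [ex_lt k p b (show (i : ℕ) + t < n + p by omega), hco _ _ _ (by omega) hp, if_pos rfl]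
      simp only [lam]
      obtain ⟨m, hm⟩ : ∃ m, min (i.val + t) (p - 1) = t + m := ⟨min (i.val + t) (p - 1) - t, by omega⟩
      rw [hm]
      have := chain m (i - m) (s - m) t (by omega) (by omega) (by omega)
      rw [show i.val + t - (t + m) = i.val - m by omega,
        show p - 1 + (s + t - (p - 1)) - (t + m) = s - m by omega, this]
      congr 2
      · omega
      · omega
    · symm
      by_cases h' : s + 1 ≤ i.val
      · exact L1 s i t (by omega) h' (by omega)
      · exact L2 t i s (by omega) (by omega)
  · intro j s t hs ht h0
    unfold ex
    split_ifs with h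
    · rw [hco _ _ _ hs ht, if_neg (by omega)]
    · exact coA_zero k p hs ht

theorem xpow_mem (N : ℕ) : ∀ (j : ℕ) (hj : j < N) (a : ℕ), j < a →
    xA k p ^ a • stdV k p N ⟨j, hj⟩ ∈ NSub k p N p := by
  intro j
  induction j with
  | zero =>
    intro hj a ha
    obtain ⟨a, rfl⟩ : ∃ a', a = a' + 1 := ⟨a - 1, by omega⟩
    rw [pow_succ, mul_smul_vec]
    exact Submodule.smul_mem _ _ (rel_x k p N p _ rfl)
  | succ j ih =>
    intro hj a ha
    obtain ⟨a, rfl⟩ : ∃ a', a = a' + 1 := ⟨a - 1, by omega⟩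
    have h1 := ih (by omega) a (by omega)
    have h2 := rel_xy k p N p ⟨j, by omega⟩ ⟨j + 1, hj⟩ rfl
    have : xA k p ^ (a + 1) • stdV k p N ⟨j + 1, hj⟩
      = yA k p • (xA k p ^ a • stdV k p N ⟨j, by omega⟩)
        - xA k p ^ a • (yA k p • stdV k p N ⟨j, by omega⟩ - xA k p • stdV k p N ⟨j + 1, hj⟩) := by
      rw [smul_sub, smul_smul, smul_smul, smul_smul, ← pow_succ, mul_comm (yA k p)]
      abel
    rw [this]
    exact sub_mem (Submodule.smul_mem _ _ h1) (Submodule.smul_mem _ _ h2)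

/-- Vectors in normal form. -/
def IsNF (N : ℕ) (b : Fin N → Amod k p) : Prop :=
  ∀ j s t, s < p → t < p → (0 < t ∨ j < s) → coA k p (ex k p b j) s t = 0

theorem nf_mono (N : ℕ) (c : k) : ∀ (t s j : ℕ) (hj : j < N),
    ∃ u, IsNF k p N u ∧
      (cA k p c * xA k p ^ s * yA k p ^ t) • stdV k p N ⟨j, hj⟩ - u ∈ NSub k p N p := by
  have z : IsNF k p N 0 := by
    intro j s t hs ht _
    have : ex k p (0 : Fin N → Amod k p) j = 0 := by unfold ex; split_ifs <;> rfl
    rw [this, coA_zero k p hs ht]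
  intro t
  induction t with
  | zero =>
    intro s j hj
    by_cases h : s ≤ j
    · refine ⟨_, ?_, by rw [sub_self]; exact zero_mem _⟩
      intro j' s' t' hs' ht' h'
      rw [ex_smul, ex_stdV]
      split_ifs with h2
      · rw [mul_one, pow_zero, mul_one, coA_cx k p _ _ hs' ht', if_neg]
        simp only at h2
        omega
      · rw [mul_zero, coA_zero k p hs' ht']
    · refine ⟨0, z, ?_⟩
      rw [sub_zero, pow_zero, mul_one, mul_smul_vec]
      exact Submodule.smul_mem _ _ (xpow_mem k p N j hj s (by omega))
  | succ t ih =>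
    intro s j hj
    by_cases h : j + 1 < N
    · obtain ⟨u, hu, hm⟩ := ih (s + 1) (j + 1) h
      refine ⟨u, hu, ?_⟩
      have h2 := rel_xy k p N p ⟨j, hj⟩ ⟨j + 1, h⟩ rfl
      have := add_mem hm (Submodule.smul_mem _ (cA k p c * xA k p ^ s * yA k p ^ t) h2)
      convert this using 1
      rw [smul_sub, smul_smul, smul_smul,
        show cA k p c * xA k p ^ s * yA k p ^ t * yA k p = cA k p c * xA k p ^ s * yA k p ^ (t + 1) by
          ring,
        show cA k p c * xA k p ^ s * yA k p ^ t * xA k p = cA k p c * xA k p ^ (s + 1) * yA k p ^ t by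
          ring]
      abel
    · refine ⟨0, z, ?_⟩
      rw [sub_zero, pow_succ, ← mul_assoc, mul_smul_vec]
      exact Submodule.smul_mem _ _ (rel_y k p N p _ (by simp only; omega))

theorem nf_add (N : ℕ) {u v : Fin N → Amod k p} (hu : IsNF k p N u) (hv : IsNF k p N v) :
    IsNF k p N (u + v) := by
  intro j s t hs ht h
  rw [ex_add, coA_add k p _ _ hs ht, hu j s t hs ht h, hv j s t hs ht h, add_zero]

theorem nf_exists (N : ℕ) (b : Fin N → Amod k p) :
    ∃ u, IsNF k p N u ∧ b - u ∈ NSub k p N p := by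
  have single : ∀ (j : Fin N) (f : Amod k p),
      ∃ u, IsNF k p N u ∧ f • stdV k p N j - u ∈ NSub k p N p := by
    intro j f
    refine A_induction k p
      (P := fun f => ∃ u, IsNF k p N u ∧ f • stdV k p N j - u ∈ NSub k p N p) ?_ ?_ f
    · rintro f g ⟨u, hu, hu'⟩ ⟨v, hv, hv'⟩
      refine ⟨u + v, nf_add k p N hu hv, ?_⟩
      have := add_mem hu' hv'
      convert this using 1
      rw [add_smul]; abel
    · intro c s t
      exact nf_mono k p N c t s j.1 j.2
  choose u hu hu' using fun j => single j (b j)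
  refine ⟨∑ j, u j, ?_, ?_⟩
  · refine Finset.sum_induction u (IsNF k p N) (fun _ _ h1 h2 => nf_add k p N h1 h2) ?_
      (fun j _ => hu j)
    intro j s t hs ht _
    have : ex k p (0 : Fin N → Amod k p) j = 0 := by unfold ex; split_ifs <;> rfl
    rw [this, coA_zero k p hs ht]
  · have hb : b = ∑ i, b i • stdV k p N i := by
      ext j
      simp [stdV, Finset.sum_apply, Pi.single_apply]
    rw [hb, ← Finset.sum_sub_distrib]
    refine Submodule.sum_mem _ (fun i _ => ?_)
    exact hu' i

theorem ker_psi (n : ℕ) (hp : 1 ≤ p) :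
    LinearMap.ker (psi k p n) = NSub k p (n + p) p := by
  have hle : NSub k p (n + p) p ≤ LinearMap.ker (psi k p n) := by
    rw [← range_phi k p (n + p) (by omega)]
    rintro _ ⟨b, rfl⟩
    exact psi_phi k p n b
  refine le_antisymm ?_ hle
  intro b hb
  obtain ⟨u, hu, hbu⟩ := nf_exists k p (n + p) b
  have h1 : psi k p n u = 0 := by
    have := hle hbu
    rw [LinearMap.mem_ker] at this hb
    rw [map_sub, hb, zero_sub, neg_eq_zero] at this
    exact this
  have h2 : u = 0 := by
    ext j
    apply coA_ext
    intro s t hs ht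
    rw [Pi.zero_apply, coA_zero k p hs ht]
    rw [← ex_val k p u j]
    by_cases h : 0 < t ∨ j.val < s
    · exact hu j s t hs ht h
    · have hj := j.2
      obtain rfl : t = 0 := by omega
      have := psi_coeff k p n u (fun j s t hs ht h => hu j s t hs ht (Or.inl h))
        ⟨j.val - min j.val (p - 1), by omega⟩ (s := p - 1 + s - min j.val (p - 1))
        (t := min j.val (p - 1)) (by omega) (by omega)
      rw [h1, Pi.zero_apply, coA_zero k p (by omega) (by omega), if_pos (by omega)] at this
      rw [this]
      congr 2
      · simp only; omega
      · omega
  rw [h2, sub_zero] at hbu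
  exact hbu

theorem mem_m_top (N : ℕ) (b : Fin N → Amod k p) (h : ∀ i, b i ∈ mA k p) :
    b ∈ mA k p • (⊤ : Submodule (Amod k p) (Fin N → Amod k p)) := by
  have hb : b = ∑ i, b i • stdV k p N i := by
    ext j
    simp [stdV, Finset.sum_apply, Pi.single_apply]
  rw [hb]
  exact Submodule.sum_mem _ (fun i _ => Submodule.smul_mem_smul (h i) trivial)

theorem xA_mem : xA k p ∈ mA k p := Ideal.subset_span (by simp)
theorem yA_mem : yA k p ∈ mA k p := Ideal.subset_span (by simp)

theorem phi_mem (n : ℕ) (a : Fin (n + 1) → Amod k p) :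
    phi k p n a ∈ mA k p • (⊤ : Submodule (Amod k p) (Fin n → Amod k p)) := by
  apply mem_m_top
  intro i
  rw [phi_apply]
  exact sub_mem (Ideal.mul_mem_right _ _ (xA_mem k p)) (Ideal.mul_mem_right _ _ (yA_mem k p))

theorem psi_mem (n : ℕ) (hp : 2 ≤ p) (a : Fin (n + p) → Amod k p) :
    psi k p n a ∈ mA k p • (⊤ : Submodule (Amod k p) (Fin (n + 1) → Amod k p)) := by
  apply mem_m_top
  intro i
  rw [psi_apply]
  refine Ideal.sum_mem _ (fun β hβ => Ideal.mul_mem_right _ _ ?_)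
  rcases Nat.eq_zero_or_pos β with h | h
  · exact Ideal.mul_mem_right _ _ (Ideal.pow_mem_of_mem _ (xA_mem k p) _ (by omega))
  · exact Ideal.mul_mem_left _ _ (Ideal.pow_mem_of_mem _ (yA_mem k p) _ h)

/-- for `n ≥ p`, every minimal second syzygy of `W_{n,p}` is isomorphic to
`W_{n+p,p}` as an `A`-module. -/
theorem minSecondSyz_Wnp_iso
    [IsAlgClosed k] [Fact p.Prime] [CharP k p]
    (n : ℕ) (hn : p ≤ n)
    (N : Type) [AddCommGroup N] [Module (Amod k p) N]
    (hN : IsMinSyz k p 2 (ModuleCat.of (Amod k p) N) (ModuleCat.of (Amod k p) (Wmod k p n p))) :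
    Nonempty (N ≃ₗ[Amod k p] Wmod k p (n + p) p) := by
  have hp2 : 2 ≤ p := (Fact.out : p.Prime).two_le
  obtain ⟨r, g, hg, kg, r', g', hg', kg', ⟨E⟩⟩ := hN
  have J := mA_le_jac k p
  -- first step: compare the kernels of the two covers of `W_{n,p}`
  obtain ⟨e1⟩ := ker_equiv (mA k p) J (LinearEquiv.refl _ (Wmod k p n p)) g
    (NSub k p n p).mkQ hg (Submodule.mkQ_surjective _) kg (by
      rw [Submodule.ker_mkQ, ← range_phi k p n (by omega)]
      rintro _ ⟨a, rfl⟩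
      exact phi_mem k p n a)
  have hr : LinearMap.ker (NSub k p n p).mkQ = LinearMap.range (phi k p n) := by
    rw [Submodule.ker_mkQ, range_phi k p n (by omega)]
  have e2 := e1.trans (LinearEquiv.ofEq _ _ hr)
  have hker : LinearMap.ker (phi k p n) = LinearMap.range (psi k p n) := by
    apply le_antisymm
    · intro a ha
      exact ker_phi_le k p n (by omega) hn a ha
    · rintro _ ⟨b, rfl⟩
      exact phi_psi k p n b
  have hrr : LinearMap.ker (phi k p n).rangeRestrict = LinearMap.range (psi k p n) := by
    rw [LinearMap.ker_rangeRestrict, hker]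
  -- second step
  obtain ⟨e3⟩ := ker_equiv (mA k p) J e2 g' (phi k p n).rangeRestrict hg'
    (LinearMap.surjective_rangeRestrict _) kg' (by
      rw [hrr]
      rintro _ ⟨b, rfl⟩
      exact psi_mem k p n hp2 b)
  have e4 : Wmod k p (n + p) p ≃ₗ[Amod k p] LinearMap.range (psi k p n) :=
    (Submodule.quotEquivOfEq _ _ (ker_psi k p n (by omega)).symm).trans
      (psi k p n).quotKerEquivRange
  have E' : N ≃ₗ[Amod k p] LinearMap.ker g' := E
  exact ⟨(E'.trans (e3.trans (LinearEquiv.ofEq _ _ hrr))).trans e4.symm⟩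

end
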